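/- arXiv:2303.11524 — 4 statements merged into one kernel-verified Lean document; each statement's English description precedes it below -/
import Mathlib

section
/- Let d ≥ 1, λ ≥ 0, T ∈ (0,∞], and let u : (0,T) × ℝ^d → (0,∞) be C¹ in t and C¹ in x, satisfying |∇u(t,·)(x)|²/u(t,x)² − ∂_t u(t,x)/u(t,x) ≤ (d + 2λ)/(2t) for all (t,x) ∈ (0,T) × ℝ^d. Then for every 0 < s < t < T and every x,y ∈ ℝ^d, u(s,x) ≤ u(t,y) (t/s)^{λ + d/2} exp{ |x−y|²/(4(t−s)) }. -/
open Real

/-- Partial derivative `∂f/∂x_j` at `x`. -/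
noncomputable def pd {d : ℕ} (f : (Fin d → ℝ) → ℝ) (j : Fin d) (x : Fin d → ℝ) : ℝ :=
  deriv (fun s => f (Function.update x j s)) (x j)

open Set Filter Topology

/-- A differentiable function attaining at `x` its minimum among points to the left of `x` has
nonpositive derivative there. -/
theorem hasDerivAt_nonpos_of_eventually_left_ge {f : ℝ → ℝ} {f' x : ℝ} (hf : HasDerivAt f f' x)
    (hmin : ∀ᶠ y in 𝓝[<] x, f x ≤ f y) : f' ≤ 0 := by
  have hslope : Tendsto (slope f x) (𝓝[<] x) (𝓝 f') :=
    (hasDerivAt_iff_tendsto_slope.1 hf).mono_left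
      (nhdsWithin_mono x fun y (hy : y < x) => hy.ne)
  refine le_of_tendsto hslope ?_
  filter_upwards [hmin, self_mem_nhdsWithin] with y hy hyx
  rw [slope_def_field]
  exact div_nonpos_of_nonneg_of_nonpos (sub_nonneg.2 hy) (sub_nonpos.2 (le_of_lt hyx))

/-- A separately continuous function that is monotone in its first variable is jointly lower
semicontinuous. -/
theorem lowerSemicontinuousAt_uncurry_of_monotoneOn {h : ℝ → ℝ → ℝ} {a b : ℝ}
    (hmono : ∀ r, MonotoneOn (fun τ => h τ r) (Ioo a b))
    (hfst : ∀ r, ∀ τ ∈ Ioo a b, ContinuousAt (fun τ => h τ r) τ)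
    (hsnd : ∀ τ ∈ Ioo a b, Continuous (h τ)) {p : ℝ × ℝ} (hp : p.1 ∈ Ioo a b) :
    LowerSemicontinuousAt (fun p : ℝ × ℝ => h p.1 p.2) p := by
  obtain ⟨τ₀, r₀⟩ := p
  intro m hm
  have hleft : ∀ᶠ τ in 𝓝[<] τ₀, m < h τ r₀ ∧ τ ∈ Ioo a b :=
    (((hfst r₀ τ₀ hp).eventually (lt_mem_nhds hm)).and
      (Ioo_mem_nhds hp.1 hp.2)).filter_mono nhdsWithin_le_nhds
  obtain ⟨τ₁, ⟨hτ₁m, hτ₁⟩, hlt⟩ := (hleft.and self_mem_nhdsWithin).exists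
  have hr : ∀ᶠ r in 𝓝 r₀, m < h τ₁ r := (hsnd τ₁ hτ₁).continuousAt.eventually (lt_mem_nhds hτ₁m)
  have hτ : ∀ᶠ τ in 𝓝 τ₀, τ ∈ Ioo τ₁ b := Ioo_mem_nhds hlt hp.2
  rw [nhds_prod_eq]
  filter_upwards [hτ.prod_mk hr] with q hq
  exact hq.2.trans_le (hmono q.2 hτ₁ ⟨hτ₁.1.trans hq.1.1, hq.1.2⟩ hq.1.1.le)

/-- Hopf–Lax bound: a separately differentiable supersolution `c ∂_τ h ≥ (∂_r h)²` dominates the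
value transported along a straight line. -/
theorem hopfLax_le {h hτ hr : ℝ → ℝ → ℝ} {a b c s t : ℝ} (hc : 0 < c)
    (hdτ : ∀ τ ∈ Ioo a b, ∀ r, HasDerivAt (fun τ => h τ r) (hτ τ r) τ)
    (hdr : ∀ τ ∈ Ioo a b, ∀ r, HasDerivAt (h τ) (hr τ r) r)
    (hsuper : ∀ τ ∈ Ioo a b, ∀ r, hr τ r ^ 2 ≤ c * hτ τ r)
    (has : a < s) (hst : s < t) (htb : t < b) :
    h s 0 ≤ h t 1 + c / (4 * (t - s)) := by
  have hcont : ∀ τ ∈ Ioo a b, Continuous (h τ) := fun τ hτ' =>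
    continuous_iff_continuousAt.2 fun r => (hdr τ hτ' r).continuousAt
  have hmono : ∀ r, MonotoneOn (fun τ => h τ r) (Ioo a b) := fun r => by
    refine monotoneOn_of_hasDerivWithinAt_nonneg (f' := fun τ => hτ τ r) (convex_Ioo a b)
      (fun τ hτ' => (hdτ τ hτ' r).continuousAt.continuousWithinAt)
      (fun τ hτ' => (hdτ τ (interior_subset hτ') r).hasDerivWithinAt) fun τ hτ' => ?_
    exact nonneg_of_mul_nonneg_right
      ((sq_nonneg _).trans (hsuper τ (interior_subset hτ') r)) hc
  have hts : 0 < t - s := sub_pos.2 hst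
  set v : ℝ := (t - s)⁻¹ with hv
  have hv0 : 0 < v := inv_pos.2 hts
  have hvts : v * (t - s) = 1 := inv_mul_cancel₀ hts.ne'
  have hIcc : ∀ τ ∈ Icc s t, τ ∈ Ioo a b := fun τ h => ⟨has.trans_le h.1, h.2.trans_lt htb⟩
  have hsI : s ∈ Ioo a b := hIcc s ⟨le_rfl, hst.le⟩
  refine le_of_forall_pos_le_add fun η hη => ?_
  obtain ⟨δ, hδ, hnear⟩ : ∃ δ > 0, ∀ r, |r| ≤ δ → h s 0 - η / 2 ≤ h s r + c * v / 2 * r := by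
    have hc' : Continuous fun r => h s r + c * v / 2 * r := (hcont s hsI).add (by fun_prop)
    have hev : ∀ᶠ r in 𝓝 (0 : ℝ), h s 0 - η / 2 < h s r + c * v / 2 * r :=
      hc'.continuousAt.eventually (lt_mem_nhds (by simp; linarith))
    obtain ⟨δ, hδ, hball⟩ := Metric.eventually_nhds_iff.1 hev
    refine ⟨δ / 2, by positivity, fun r hr' => (hball ?_).le⟩
    rw [Real.dist_eq, sub_zero]
    linarith
  obtain ⟨m, hm⟩ : ∃ m, ∀ r ∈ Icc (-δ) (1 + δ), m ≤ h s r := by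
    obtain ⟨m, hm⟩ := (isCompact_Icc (a := -δ) (b := 1 + δ)).bddBelow_image (hcont s hsI).continuousOn
    exact ⟨m, fun r hr' => hm ⟨r, hr', rfl⟩⟩
  set ε : ℝ := η * v / 2 with hε
  have hε0 : 0 < ε := by positivity
  obtain ⟨K, hK0, hK⟩ : ∃ K : ℝ, 0 ≤ K ∧
      h s 0 - η / 2 ≤ m - c * v / 2 * δ - c * v / 4 + K * δ ^ 2 := by
    refine ⟨max 0 ((h s 0 - η / 2 - (m - c * v / 2 * δ - c * v / 4)) / δ ^ 2),
      le_max_left _ _, ?_⟩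
    have := (div_le_iff₀ (by positivity)).1
      (le_max_right 0 ((h s 0 - η / 2 - (m - c * v / 2 * δ - c * v / 4)) / δ ^ 2))
    linarith
  set ψ : ℝ → ℝ → ℝ := fun τ r =>
    -(c * v / 2) * r + (c * v ^ 2 / 4 - ε) * (τ - s) - K * (r - v * (τ - s)) ^ 2 with hψ
  set tube : Set (ℝ × ℝ) := {p | p.1 ∈ Icc s t ∧ |p.2 - v * (p.1 - s)| ≤ δ} with htube
  have htime : ∀ τ ∈ Icc s t, 0 ≤ v * (τ - s) ∧ v * (τ - s) ≤ 1 := fun τ h =>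
    ⟨mul_nonneg hv0.le (sub_nonneg.2 h.1),
      hvts ▸ mul_le_mul_of_nonneg_left (sub_le_sub_right h.2 s) hv0.le⟩
  have htube_sub : tube ⊆ Icc s t ×ˢ Icc (-δ) (1 + δ) := by
    rintro ⟨τ, r⟩ ⟨h1, h2⟩
    have := htime τ h1
    rw [abs_le] at h2
    simp only at h2
    exact ⟨h1, by simp only; linarith, by simp only; linarith⟩
  have hcompact : IsCompact tube := by
    refine (isCompact_Icc.prod isCompact_Icc).of_isClosed_subset ?_ htube_sub
    have hcont' : Continuous fun p : ℝ × ℝ => |p.2 - v * (p.1 - s)| := by fun_prop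
    exact (isClosed_Icc.preimage continuous_fst).inter (isClosed_le hcont' continuous_const)
  have hend : ((t, 1) : ℝ × ℝ) ∈ tube := ⟨⟨hst.le, le_rfl⟩, by simp [hvts, hδ.le]⟩
  have hlsc : LowerSemicontinuousOn (fun p : ℝ × ℝ => h p.1 p.2 + -ψ p.1 p.2) tube := by
    intro p hp
    refine LowerSemicontinuousWithinAt.add ?_ ?_
    · exact (lowerSemicontinuousAt_uncurry_of_monotoneOn hmono
        (fun r τ hτ' => (hdτ τ hτ' r).continuousAt) hcont
        (hIcc _ hp.1)).lowerSemicontinuousWithinAt _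
    · have : Continuous fun p : ℝ × ℝ => -ψ p.1 p.2 := by simp only [hψ]; fun_prop
      exact this.continuousAt.lowerSemicontinuousAt.lowerSemicontinuousWithinAt _
  obtain ⟨⟨τ₀, r₀⟩, hp₀, hmin⟩ := hlsc.exists_isMinOn ⟨_, hend⟩ hcompact
  have hτ₀ : τ₀ ∈ Icc s t := hp₀.1
  have hτ₀I := hIcc τ₀ hτ₀
  have hq₀ : |r₀ - v * (τ₀ - s)| ≤ δ := hp₀.2
  have hbound : h s 0 - η / 2 ≤ h τ₀ r₀ + -ψ τ₀ r₀ := by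
    rcases hτ₀.1.eq_or_lt with rfl | hsτ
    · have := hnear r₀ (by simpa using hq₀)
      simp only [hψ, sub_self, mul_zero, sub_zero]
      nlinarith [mul_nonneg hK0 (sq_nonneg r₀)]
    rcases hq₀.eq_or_lt with hq | hq
    · have h1 : h s r₀ ≤ h τ₀ r₀ := hmono r₀ hsI hτ₀I hτ₀.1
      have h2 := hm r₀ (htube_sub hp₀).2
      have h3 : (r₀ - v * (τ₀ - s)) ^ 2 = δ ^ 2 := by rw [← sq_abs, hq]
      have h4 : c * v / 2 * (-δ) ≤ c * v / 2 * r₀ :=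
        mul_le_mul_of_nonneg_left (htube_sub hp₀).2.1 (by positivity)
      have h5 : c * v / 4 * (v * (τ₀ - s)) ≤ c * v / 4 * 1 :=
        mul_le_mul_of_nonneg_left (htime τ₀ hτ₀).2 (by positivity)
      have h6 : 0 ≤ ε * (τ₀ - s) := mul_nonneg hε0.le (sub_nonneg.2 hτ₀.1)
      simp only [hψ, h3]
      linarith
    · exfalso
      have hdψr : HasDerivAt (ψ τ₀) (-(c * v / 2) - 2 * K * (r₀ - v * (τ₀ - s))) r₀ := by
        have := (((hasDerivAt_id r₀).const_mul (-(c * v / 2))).add_const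
          ((c * v ^ 2 / 4 - ε) * (τ₀ - s))).sub
          ((((hasDerivAt_id r₀).sub_const (v * (τ₀ - s))).pow 2).const_mul K)
        refine this.congr_deriv ?_
        simp; ring
      have hdψτ : HasDerivAt (fun τ => ψ τ r₀)
          (c * v ^ 2 / 4 - ε + 2 * K * v * (r₀ - v * (τ₀ - s))) τ₀ := by
        have hid := (hasDerivAt_id τ₀).sub_const s
        have := ((hid.const_mul (c * v ^ 2 / 4 - ε)).const_add (-(c * v / 2) * r₀)).sub
          ((((hid.const_mul v).const_sub r₀).pow 2).const_mul K)
        refine this.congr_deriv ?_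
        simp; ring
      have hr0 : hr τ₀ r₀ + -(-(c * v / 2) - 2 * K * (r₀ - v * (τ₀ - s))) = 0 := by
        refine IsLocalMin.hasDerivAt_eq_zero ?_ ((hdr τ₀ hτ₀I r₀).add hdψr.neg)
        have hev : ∀ᶠ r in 𝓝 r₀, |r - v * (τ₀ - s)| < δ :=
          ContinuousAt.eventually_lt (by fun_prop) continuousAt_const hq
        filter_upwards [hev] with r hr'
        exact hmin (show (τ₀, r) ∈ tube from ⟨hτ₀, hr'.le⟩)
      have hτ0 : hτ τ₀ r₀ + -(c * v ^ 2 / 4 - ε + 2 * K * v * (r₀ - v * (τ₀ - s))) ≤ 0 := by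
        refine hasDerivAt_nonpos_of_eventually_left_ge ((hdτ τ₀ hτ₀I r₀).add hdψτ.neg) ?_
        have hev : ∀ᶠ τ in 𝓝 τ₀, |r₀ - v * (τ - s)| < δ :=
          ContinuousAt.eventually_lt (by fun_prop) continuousAt_const hq
        filter_upwards [hev.filter_mono nhdsWithin_le_nhds,
          (lt_mem_nhds hsτ).filter_mono nhdsWithin_le_nhds, self_mem_nhdsWithin] with τ h1 h2 h3
        exact hmin (show (τ, r₀) ∈ tube from ⟨⟨h2.le, (le_of_lt h3).trans hτ₀.2⟩, h1.le⟩)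
      have hs' := hsuper τ₀ hτ₀I r₀
      rw [show hr τ₀ r₀ = -(c * v / 2) - 2 * K * (r₀ - v * (τ₀ - s)) by linarith] at hs'
      have h7 := mul_le_mul_of_nonneg_left hτ0 hc.le
      nlinarith [mul_pos hc hε0, sq_nonneg (2 * K * (r₀ - v * (τ₀ - s)))]
  have hfinal := hbound.trans (hmin hend)
  have hcv : c / (4 * (t - s)) = c * v / 4 := by rw [hv]; field_simp
  have hψend : ψ t 1 = -(c * v / 4) - η / 2 := by
    simp only [hψ, hvts, hε]
    linear_combination (c * v / 4 - η / 2) * hvts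
  simp only [hψend] at hfinal
  rw [hcv]
  linarith

/-- The derivative of `f` along an affine line, in terms of its partial derivatives. -/
theorem hasDerivAt_comp_line {d : ℕ} {f : (Fin d → ℝ) → ℝ} (hf : Differentiable ℝ f)
    (x w : Fin d → ℝ) (r : ℝ) :
    HasDerivAt (fun r : ℝ => f (x + r • w)) (∑ j, w j * pd f j (x + r • w)) r := by
  have hpd : ∀ (z : Fin d → ℝ) j, pd f j z = fderiv ℝ f z (Pi.single j 1) := fun z j => by
    have hz : HasFDerivAt f (fderiv ℝ f z) (Function.update z j (z j)) := by
      rw [Function.update_eq_self]; exact (hf z).hasFDerivAt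
    exact (hz.comp_hasDerivAt (z j) (hasDerivAt_update z j (z j))).deriv
  have hline : HasDerivAt (fun r : ℝ => x + r • w) w r := by
    simpa using ((hasDerivAt_id r).smul_const w).const_add x
  refine ((hf _).hasFDerivAt.comp_hasDerivAt r hline).congr_deriv ?_
  generalize x + r • w = z
  conv_lhs => rw [pi_eq_sum_univ' w]
  simp [hpd, map_sum]

/-- **Parabolic Harnack inequality for the Dunkl heat equation**: if a positive
function `u`, `C¹` in `t` and `C¹` in `x`, satisfies the Li–Yau estimate
`|∇u|²/u² − ∂_t u/u ≤ (d + 2λ)/(2t)` on `(0,T) × ℝ^d`, then for all `0 < s < t < T`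
and `x, y ∈ ℝ^d`, `u(s,x) ≤ u(t,y) (t/s)^{λ+d/2} exp{|x−y|²/(4(t−s))}`. -/
theorem stmt13 (d : ℕ) (hd : 1 ≤ d) (lam : ℝ) (hlam : 0 ≤ lam)
    (T : EReal) (hT : 0 < T)
    (u : ℝ → (Fin d → ℝ) → ℝ)
    (hupos : ∀ (t : ℝ) x, 0 < t → (t : EReal) < T → 0 < u t x)
    (huC1t : ∀ x, ContDiffOn ℝ 1 (fun s => u s x) {s : ℝ | 0 < s ∧ (s : EReal) < T})
    (huC1x : ∀ (t : ℝ), 0 < t → (t : EReal) < T → ContDiff ℝ 1 (fun z => u t z))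
    (hLY : ∀ (t : ℝ) x, 0 < t → (t : EReal) < T →
      (∑ j, (pd (fun z => u t z) j x) ^ 2) / (u t x) ^ 2
          - deriv (fun s => u s x) t / u t x
        ≤ ((d : ℝ) + 2 * lam) / (2*t))
    (s t : ℝ) (hs : 0 < s) (hst : s < t) (htT : (t : EReal) < T)
    (x y : Fin d → ℝ) :
    u s x ≤ u t y * (t / s) ^ (lam + (d : ℝ)/2)
      * Real.exp ((∑ j, (x j - y j) ^ 2) / (4 * (t - s))) := by
  obtain ⟨b, htb, hbT⟩ := EReal.lt_iff_exists_real_btwn.1 htT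
  have htb : t < b := EReal.coe_lt_coe_iff.1 htb
  have hbT' : ∀ τ ∈ Ioo 0 b, (τ : EReal) < T := fun τ h =>
    (EReal.coe_lt_coe_iff.2 h.2).trans hbT
  have ht : 0 < t := hs.trans hst
  have hsT : (s : EReal) < T := (EReal.coe_lt_coe_iff.2 hst).trans htT
  set C : ℝ := lam + d / 2 with hC
  have hdu : ∀ τ ∈ Ioo 0 b, ∀ z, HasDerivAt (fun τ => u τ z) (deriv (fun τ => u τ z) τ) τ := by
    intro τ hτ z
    have hmem : {s : ℝ | 0 < s ∧ (s : EReal) < T} ∈ 𝓝 τ :=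
      mem_of_superset (Ioo_mem_nhds hτ.1 hτ.2) fun σ hσ => ⟨hσ.1, hbT' σ hσ⟩
    exact (((huC1t z).contDiffAt hmem).differentiableAt (by norm_num)).hasDerivAt
  have hdlog : ∀ τ ∈ Ioo 0 b, ∀ z, HasDerivAt (fun τ => log (u τ z) + C * log τ)
      (deriv (fun τ => u τ z) τ / u τ z + C / τ) τ := fun τ hτ z =>
    ((hdu τ hτ z).log (hupos τ z hτ.1 (hbT' τ hτ)).ne').add
      ((hasDerivAt_log hτ.1.ne').const_mul C)
  have hLY' : ∀ τ ∈ Ioo 0 b, ∀ z, (∑ j, pd (u τ) j z ^ 2) / u τ z ^ 2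
      ≤ deriv (fun τ => u τ z) τ / u τ z + C / τ := by
    intro τ hτ z
    have h1 := hLY τ z hτ.1 (hbT' τ hτ)
    have h2 : ((d : ℝ) + 2 * lam) / (2 * τ) = C / τ := by
      have := hτ.1.ne'
      rw [hC]; field_simp; ring
    linarith
  have hlog : log (u s x) + C * log s ≤
      log (u t y) + C * log t + (∑ j, (x j - y j) ^ 2) / (4 * (t - s)) := by
    have hc0 : 0 ≤ ∑ j, (x j - y j) ^ 2 := Finset.sum_nonneg fun j _ => sq_nonneg _
    rcases hc0.eq_or_lt with hc | hc
    · have hxy : x = y := funext fun j => by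
        have := (Finset.sum_eq_zero_iff_of_nonneg fun j _ => sq_nonneg (x j - y j)).1 hc.symm j
          (Finset.mem_univ j)
        exact sub_eq_zero.1 (pow_eq_zero_iff two_ne_zero |>.1 this)
      rw [← hc, zero_div, add_zero, ← hxy]
      have hmono : MonotoneOn (fun τ => log (u τ x) + C * log τ) (Ioo 0 b) := by
        refine monotoneOn_of_hasDerivWithinAt_nonneg (convex_Ioo 0 b)
          (fun τ hτ => (hdlog τ hτ x).continuousAt.continuousWithinAt)
          (fun τ hτ => (hdlog τ (interior_subset hτ) x).hasDerivWithinAt) fun τ hτ => ?_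
        exact (by positivity : (0 : ℝ) ≤ (∑ j, pd (u τ) j x ^ 2) / u τ x ^ 2).trans
          (hLY' τ (interior_subset hτ) x)
      exact hmono ⟨hs, hst.trans htb⟩ ⟨ht, htb⟩ hst.le
    · have key := hopfLax_le (h := fun τ r => log (u τ (x + r • (y - x))) + C * log τ)
        (hr := fun τ r => (∑ j, (y - x) j * pd (u τ) j (x + r • (y - x))) /
          u τ (x + r • (y - x))) hc (fun τ hτ r => hdlog τ hτ (x + r • (y - x)))
        (fun τ hτ r => ((hasDerivAt_comp_line
          ((huC1x τ hτ.1 (hbT' τ hτ)).differentiable (by norm_num)) x (y - x) r).log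
          (hupos τ _ hτ.1 (hbT' τ hτ)).ne').add_const _) (fun τ hτ r => ?_) hs hst htb
      · simpa using key
      · refine le_trans ?_ (mul_le_mul_of_nonneg_left (hLY' τ hτ _) hc.le)
        rw [div_pow, ← mul_div_assoc]
        gcongr
        refine (Finset.sum_mul_sq_le_sq_mul_sq _ _ _).trans_eq ?_
        congr 1
        exact Finset.sum_congr rfl fun j _ => by rw [Pi.sub_apply, sub_sq_comm]
  have hus := hupos s x hs hsT
  have hut := hupos t y ht htT
  rw [← log_le_log_iff hus (by positivity), log_mul (by positivity) (by positivity),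
    log_mul hut.ne' (by positivity), log_exp, log_rpow (by positivity), log_div ht.ne' hs.ne']
  linarith
end

section
/- Let I ⊆ ℝ be an interval, ψ ∈ C²(I), and f ∈ C²(ℝ^d, I). Then at every point x ∈ ℝ^d with ⟨α,x⟩ ≠ 0 for all α ∈ R₊, Δ_κ(ψ ∘ f)(x) = ψ'(f(x)) Δ_κ f(x) + ψ''(f(x)) |∇f(x)|² + Π_ψ(f)(x), where Π_ψ(f)(x) = 2 Σ_{α∈R₊} κ_α π_ψ(f(σ_α x), f(x)) / ⟨α,x⟩² and π_ψ(a,b) = ψ(a) − ψ(b) − ψ'(b)(a−b). -/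
open Real

/-- The standard Laplacian `Δ f(x) = Σ_j ∂²f/∂x_j²(x)` on `ℝ^d`. -/
noncomputable def stdLap {d : ℕ} (f : (Fin d → ℝ) → ℝ) (x : Fin d → ℝ) : ℝ :=
  ∑ j, pd (fun z => pd f j z) j x

/-- The reflection `σ_α x = x − ⟨α,x⟩ α` in the hyperplane `α^⊥` (for `|α|² = 2`). -/
def reflAlpha {d : ℕ} (α x : Fin d → ℝ) : Fin d → ℝ :=
  fun i => x i - (∑ k, α k * x k) * α i

/-- The Dunkl Laplacian associated with the subsystem `R₊` and multiplicity `κ`. -/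
noncomputable def dunklLapG {d : ℕ} (Rp : Finset (Fin d → ℝ)) (κ : (Fin d → ℝ) → ℝ)
    (f : (Fin d → ℝ) → ℝ) (x : Fin d → ℝ) : ℝ :=
  stdLap f x + 2 * ∑ α ∈ Rp, κ α *
    ((∑ i, α i * pd f i x) / (∑ i, α i * x i)
      - (f x - f (reflAlpha α x)) / (∑ i, α i * x i) ^ 2)

theorem hasDerivAt_update_pd {d : ℕ} {f : (Fin d → ℝ) → ℝ} (j : Fin d) {x : Fin d → ℝ}
    (hf : DifferentiableAt ℝ f x) :
    HasDerivAt (fun s => f (Function.update x j s)) (pd f j x) (x j) := by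
  have hf' : DifferentiableAt ℝ f (Function.update x j (x j)) := by
    rwa [Function.update_eq_self]
  exact (hf'.comp (x j) (hasDerivAt_update x j (x j)).differentiableAt).hasDerivAt

theorem pd_eq_fderiv {d : ℕ} {f : (Fin d → ℝ) → ℝ} (j : Fin d) {x : Fin d → ℝ}
    (hf : DifferentiableAt ℝ f x) : pd f j x = fderiv ℝ f x (Pi.single j 1) := by
  have hf' : HasFDerivAt f (fderiv ℝ f x) (Function.update x j (x j)) := by
    rw [Function.update_eq_self]
    exact hf.hasFDerivAt
  exact (hf'.comp_hasDerivAt (x j) (hasDerivAt_update x j (x j))).deriv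

theorem differentiable_pd {d : ℕ} {f : (Fin d → ℝ) → ℝ} (hf : ContDiff ℝ 2 f) (j : Fin d) :
    Differentiable ℝ (pd f j) := by
  have h : pd f j = fun z => fderiv ℝ f z (Pi.single j 1) :=
    funext fun z => pd_eq_fderiv j (hf.differentiable two_ne_zero z)
  rw [h]
  exact ((hf.fderiv_right (m := 1) (by norm_num)).differentiable one_ne_zero).clm_apply
    (differentiable_const _)

theorem hasDerivAt_comp_update {d : ℕ} {I : Set ℝ} {φ : ℝ → ℝ} {c : ℝ}
    {f : (Fin d → ℝ) → ℝ} (j : Fin d) {x : Fin d → ℝ} (hf : DifferentiableAt ℝ f x)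
    (hfI : ∀ z, f z ∈ I) (hφ : HasDerivWithinAt φ c I (f x)) :
    HasDerivAt (fun s => φ (f (Function.update x j s))) (c * pd f j x) (x j) := by
  have hφ' : HasDerivWithinAt φ c I (f (Function.update x j (x j))) := by
    rwa [Function.update_eq_self]
  exact hφ'.comp_hasDerivAt (x j) (hasDerivAt_update_pd j hf) (.of_forall fun _ => hfI _)

theorem stdLap_comp {d : ℕ} {I : Set ℝ} {ψ ψ' ψ'' : ℝ → ℝ}
    (hψ1 : ∀ a ∈ I, HasDerivWithinAt ψ (ψ' a) I a)
    (hψ2 : ∀ a ∈ I, HasDerivWithinAt ψ' (ψ'' a) I a)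
    {f : (Fin d → ℝ) → ℝ} (hf : ContDiff ℝ 2 f) (hfI : ∀ z, f z ∈ I) (x : Fin d → ℝ) :
    stdLap (fun z => ψ (f z)) x
      = ψ' (f x) * stdLap f x + ψ'' (f x) * ∑ j, (pd f j x) ^ 2 := by
  have hd : Differentiable ℝ f := hf.differentiable two_ne_zero
  simp only [stdLap, Finset.mul_sum, ← Finset.sum_add_distrib]
  refine Finset.sum_congr rfl fun j _ => ?_
  have h1 : (fun z => pd (fun z => ψ (f z)) j z) = fun z => ψ' (f z) * pd f j z :=
    funext fun z => (hasDerivAt_comp_update j (hd z) hfI (hψ1 _ (hfI z))).deriv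
  have h2 := (hasDerivAt_comp_update j (hd x) hfI (hψ2 _ (hfI x))).mul
    (hasDerivAt_update_pd j (differentiable_pd hf j x))
  rw [h1]
  refine h2.deriv.trans ?_
  simp only [Function.update_eq_self]
  ring

/-- **Chain rule for the Dunkl Laplacian**: for `ψ ∈ C²(I)` and `f ∈ C²(ℝ^d, I)`, at
every `x` with `⟨α,x⟩ ≠ 0` for all `α ∈ R₊`,
`Δ_κ(ψ∘f)(x) = ψ'(f(x)) Δ_κ f(x) + ψ''(f(x)) |∇f(x)|² + Π_ψ(f)(x)`, where
`Π_ψ(f)(x) = 2 Σ_{α∈R₊} κ_α π_ψ(f(σ_α x), f(x))/⟨α,x⟩²` and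
`π_ψ(a,b) = ψ(a) − ψ(b) − ψ'(b)(a−b)`. -/
theorem stmt14 (d : ℕ) (Rp : Finset (Fin d → ℝ))
    (hRp : ∀ α ∈ Rp, ∑ i, (α i) ^ 2 = 2)
    (κ : (Fin d → ℝ) → ℝ) (hκ : ∀ α ∈ Rp, 0 ≤ κ α)
    (I : Set ℝ) (hI : I.OrdConnected)
    (ψ ψ' ψ'' : ℝ → ℝ)
    (hψ1 : ∀ a ∈ I, HasDerivWithinAt ψ (ψ' a) I a)
    (hψ2 : ∀ a ∈ I, HasDerivWithinAt ψ' (ψ'' a) I a)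
    (hψ2c : ContinuousOn ψ'' I)
    (f : (Fin d → ℝ) → ℝ) (hf : ContDiff ℝ 2 f) (hfI : ∀ z, f z ∈ I)
    (x : Fin d → ℝ) (hx : ∀ α ∈ Rp, (∑ i, α i * x i) ≠ 0) :
    dunklLapG Rp κ (fun z => ψ (f z)) x
      = ψ' (f x) * dunklLapG Rp κ f x + ψ'' (f x) * ∑ j, (pd f j x) ^ 2
        + 2 * ∑ α ∈ Rp, κ α *
            ((ψ (f (reflAlpha α x)) - ψ (f x) - ψ' (f x) * (f (reflAlpha α x) - f x))
              / (∑ i, α i * x i) ^ 2) := by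
  have hpd : ∀ i, pd (fun z => ψ (f z)) i x = ψ' (f x) * pd f i x := fun i =>
    (hasDerivAt_comp_update i (hf.differentiable two_ne_zero x) hfI (hψ1 _ (hfI x))).deriv
  have hgrad : ∀ α : Fin d → ℝ, ∑ i, α i * pd (fun z => ψ (f z)) i x
      = ψ' (f x) * ∑ i, α i * pd f i x := fun α => by
    rw [Finset.mul_sum]
    exact Finset.sum_congr rfl fun i _ => by rw [hpd]; ring
  have hsum : ∑ α ∈ Rp, κ α * ((∑ i, α i * pd (fun z => ψ (f z)) i x) / (∑ i, α i * x i)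
        - (ψ (f x) - ψ (f (reflAlpha α x))) / (∑ i, α i * x i) ^ 2)
      = ψ' (f x) * ∑ α ∈ Rp, κ α * ((∑ i, α i * pd f i x) / (∑ i, α i * x i)
        - (f x - f (reflAlpha α x)) / (∑ i, α i * x i) ^ 2)
      + ∑ α ∈ Rp, κ α *
          ((ψ (f (reflAlpha α x)) - ψ (f x) - ψ' (f x) * (f (reflAlpha α x) - f x))
            / (∑ i, α i * x i) ^ 2) := by
    rw [Finset.mul_sum, ← Finset.sum_add_distrib]
    exact Finset.sum_congr rfl fun α _ => by rw [hgrad]; ring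
  rw [dunklLapG, dunklLapG, stdLap_comp hψ1 hψ2 hf hfI, hsum]
  ring
end

section
/- Let κ > 0 and t > 0. Then for every u,v ∈ ℝ, the second derivative in u of log h_t^{(κ)}(u,v) satisfies ∂²_{uu} log h_t^{(κ)}(u,v) ≥ −coth(2t). -/
open Real MeasureTheory

/-- The one-dimensional kernel `h_t^{(κ)}(u,v)` of the Dunkl harmonic oscillator. -/
noncomputable def hKer (κ t u v : ℝ) : ℝ :=
  ((2 : ℝ) ^ (κ + 1/2) * Real.sqrt π * Real.Gamma (κ + 1/2))⁻¹
    * Real.sinh (2*t) ^ (-(κ + 1/2))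
    * Real.exp (-(1/2) * (Real.cosh (2*t) / Real.sinh (2*t)) * (u^2 + v^2))
    * ∫ s in (-1 : ℝ)..(1 : ℝ),
        (1 - s) ^ (κ - 1) * (1 + s) ^ κ * Real.exp (u * v * s / Real.sinh (2*t))

open ProbabilityTheory

/-- The Jacobi weight `(1 - s) ^ (κ - 1) * (1 + s) ^ κ`. -/
noncomputable def jacobiWeight (κ s : ℝ) : ℝ := (1 - s) ^ (κ - 1) * (1 + s) ^ κ

/-- The measure on `(-1, 1]` whose density is the Jacobi weight. -/
noncomputable def jacobiMeasure (κ : ℝ) : Measure ℝ :=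
  (volume.restrict (Set.Ioc (-1) 1)).withDensity fun s => ((jacobiWeight κ s).toNNReal : ENNReal)

lemma measurable_jacobiWeight (κ : ℝ) : Measurable (jacobiWeight κ) := by
  unfold jacobiWeight
  fun_prop

lemma intervalIntegrable_jacobiWeight {κ : ℝ} (hκ : 0 < κ) :
    IntervalIntegrable (jacobiWeight κ) volume (-1) 1 := by
  have h : IntervalIntegrable (fun s : ℝ => (1 - s) ^ (κ - 1)) volume (-1) 1 := by
    have := (intervalIntegral.intervalIntegrable_rpow' (a := 2) (b := 0)
      (show -1 < κ - 1 by linarith)).comp_sub_left 1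
    norm_num at this
    exact this
  refine h.mul_continuousOn (ContinuousOn.rpow_const (by fun_prop) fun _ _ => Or.inr hκ.le)

lemma jacobiWeight_nonneg (κ : ℝ) {s : ℝ} (hs : s ∈ Set.Ioc (-1 : ℝ) 1) :
    0 ≤ jacobiWeight κ s :=
  mul_nonneg (rpow_nonneg (by linarith [hs.2]) _) (rpow_nonneg (by linarith [hs.1]) _)

lemma integral_jacobiMeasure (κ : ℝ) (g : ℝ → ℝ) :
    ∫ s, g s ∂jacobiMeasure κ = ∫ s in (-1 : ℝ)..1, jacobiWeight κ s * g s := by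
  rw [jacobiMeasure, integral_withDensity_eq_integral_smul
    (measurable_jacobiWeight κ).real_toNNReal, intervalIntegral.integral_of_le (by norm_num)]
  refine setIntegral_congr_fun measurableSet_Ioc fun s hs => ?_
  simp [NNReal.smul_def, jacobiWeight_nonneg κ hs]

lemma isFiniteMeasure_jacobiMeasure {κ : ℝ} (hκ : 0 < κ) :
    IsFiniteMeasure (jacobiMeasure κ) :=
  isFiniteMeasure_withDensity_ofReal
    ((intervalIntegrable_iff_integrableOn_Ioc_of_le (by norm_num)).1
      (intervalIntegrable_jacobiWeight hκ)).hasFiniteIntegral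

lemma jacobiMeasure_ne_zero {κ : ℝ} (hκ : 0 < κ) : jacobiMeasure κ ≠ 0 := by
  intro h0
  have h := integral_jacobiMeasure κ fun _ => 1
  have hpos := intervalIntegral.intervalIntegral_pos_of_pos_on
    (intervalIntegrable_jacobiWeight hκ) (fun s hs =>
      mul_pos (rpow_pos_of_pos (by linarith [hs.2]) _) (rpow_pos_of_pos (by linarith [hs.1]) _))
    (by norm_num)
  simp only [h0, integral_zero_measure, mul_one] at h
  exact hpos.ne h

lemma integrable_exp_mul_jacobiMeasure {κ : ℝ} (hκ : 0 < κ) (b w : ℝ) :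
    Integrable (fun s => exp (w * (b * s))) (jacobiMeasure κ) := by
  have := isFiniteMeasure_jacobiMeasure hκ
  have hmem : ∀ᵐ s ∂jacobiMeasure κ, s ∈ Set.Icc (-1 : ℝ) 1 :=
    (withDensity_absolutelyContinuous _ _).ae_le <|
      (ae_restrict_mem measurableSet_Ioc).mono fun s hs => Set.Ioc_subset_Icc_self hs
  simpa only [mul_assoc] using
    integrable_exp_mul_of_mem_Icc (X := fun s => s) (t := w * b) aemeasurable_id hmem

/-- The logarithm of the kernel is a quadratic plus a cumulant generating function. -/
lemma log_hKer {κ t : ℝ} (hκ : 0 < κ) (ht : 0 < t) (w v : ℝ) :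
    log (hKer κ t w v) =
      log (((2 : ℝ) ^ (κ + 1/2) * √π * Gamma (κ + 1/2))⁻¹ * sinh (2*t) ^ (-(κ + 1/2)))
        + -(1/2) * (cosh (2*t) / sinh (2*t)) * (w^2 + v^2)
        + cgf (fun s => v / sinh (2*t) * s) (jacobiMeasure κ) w := by
  have hs : 0 < sinh (2*t) := sinh_pos_iff.2 (by linarith)
  have hG : 0 < Gamma (κ + 1/2) := Gamma_pos_of_pos (by linarith)
  have hc : 0 < ((2 : ℝ) ^ (κ + 1/2) * √π * Gamma (κ + 1/2))⁻¹ * sinh (2*t) ^ (-(κ + 1/2)) := by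
    positivity
  have hm : ∫ s in (-1 : ℝ)..1, (1 - s) ^ (κ - 1) * (1 + s) ^ κ * exp (w * v * s / sinh (2*t))
      = mgf (fun s => v / sinh (2*t) * s) (jacobiMeasure κ) w := by
    rw [mgf, integral_jacobiMeasure]
    refine intervalIntegral.integral_congr fun s _ => ?_
    simp only [jacobiWeight]
    congr 2
    ring
  have hpos := mgf_pos' (jacobiMeasure_ne_zero hκ)
    (integrable_exp_mul_jacobiMeasure hκ (v / sinh (2*t)) w)
  rw [hKer, hm, log_mul (by positivity) hpos.ne', log_mul hc.ne' (exp_pos _).ne', log_exp, cgf]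

lemma iteratedDeriv_two_cgf_nonneg {Ω : Type*} [MeasurableSpace Ω] {X : Ω → ℝ} {μ : Measure Ω}
    {w : ℝ} (hw : w ∈ interior (integrableExpSet X μ)) : 0 ≤ iteratedDeriv 2 (cgf X μ) w := by
  rw [← variance_tilted_mul hw]
  exact variance_nonneg _ _

/-- For `κ > 0` and `t > 0`, the second logarithmic derivative of the one-dimensional
kernel satisfies `∂²_{uu} log h_t^{(κ)}(u,v) ≥ −coth(2t)` for all `u, v ∈ ℝ`. -/
theorem stmt16 (κ t : ℝ) (hκ : 0 < κ) (ht : 0 < t) (u v : ℝ) :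
    -(Real.cosh (2*t) / Real.sinh (2*t))
      ≤ deriv (deriv (fun w => Real.log (hKer κ t w v))) u := by
  have hset (w : ℝ) : w ∈ interior
      (integrableExpSet (fun s => v / sinh (2*t) * s) (jacobiMeasure κ)) := by
    have : integrableExpSet (fun s => v / sinh (2*t) * s) (jacobiMeasure κ) = Set.univ :=
      Set.eq_univ_of_forall fun x => integrable_exp_mul_jacobiMeasure hκ _ x
    simp [this]
  have hnonneg := iteratedDeriv_two_cgf_nonneg (hset u)
  rw [iteratedDeriv_succ, iteratedDeriv_one] at hnonneg
  have han (w : ℝ) := analyticAt_cgf (hset w)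
  simp_rw [log_hKer hκ ht]
  set C := log (((2 : ℝ) ^ (κ + 1/2) * √π * Gamma (κ + 1/2))⁻¹ * sinh (2*t) ^ (-(κ + 1/2)))
  set a := cosh (2*t) / sinh (2*t)
  set f := cgf (fun s => v / sinh (2*t) * s) (jacobiMeasure κ)
  have h1 : deriv (fun w => C + -(1/2) * a * (w^2 + v^2) + f w) = fun w => -a * w + deriv f w := by
    funext w
    have hq := ((((hasDerivAt_id w).pow 2).add_const (v^2)).const_mul (-(1/2) * a)).const_add C
    refine ((hq.add (han w).differentiableAt.hasDerivAt).congr_deriv ?_).deriv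
    simp
    ring
  have h2 : deriv (fun w => -a * w + deriv f w) u = -a + deriv (deriv f) u := by
    have := ((hasDerivAt_id u).const_mul (-a)).add (han u).deriv.differentiableAt.hasDerivAt
    exact this.deriv.trans (by simp)
  rw [h1, h2]
  linarith
end

section
/- Let κ > 0 and set g(s) = (1−s)^{κ−1}(1+s)^{κ} for s ∈ (−1,1). Then for every a ∈ ℝ, φ(a) := 2a (∫_{−1}^1 s g(s) e^{as} ds)/(∫_{−1}^1 g(s) e^{as} ds) + log( (∫_{−1}^1 g(s) e^{−as} ds)/(∫_{−1}^1 g(s) e^{as} ds) ) ≥ 0. -/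
open Real MeasureTheory

/-- If `w` and `w e^{-t}` are weights with `w` of positive mass, Jensen's inequality for the
exponential bounds the logarithm of the ratio of their masses from below by minus the mean
of `t`. -/
theorem neg_mean_le_log_integral_exp_neg {u v : ℝ} (huv : u ≤ v) {w t : ℝ → ℝ}
    (hw : IntervalIntegrable w volume u v)
    (htw : IntervalIntegrable (fun s => t s * w s) volume u v)
    (hexp : IntervalIntegrable (fun s => w s * Real.exp (-t s)) volume u v)
    (hw0 : ∀ s ∈ Set.Icc u v, 0 ≤ w s) (hpos : 0 < ∫ s in u..v, w s) :
    -((∫ s in u..v, t s * w s) / ∫ s in u..v, w s) ≤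
      Real.log ((∫ s in u..v, w s * Real.exp (-t s)) / ∫ s in u..v, w s) := by
  set Z := ∫ s in u..v, w s with hZ
  set M := ∫ s in u..v, t s * w s with hM
  set m := M / Z with hm
  have hmZ : m * Z = M := div_mul_cancel₀ M hpos.ne'
  have key : Real.exp (-m) * Z ≤ ∫ s in u..v, w s * Real.exp (-t s) := by
    have heq : ∫ s in u..v, Real.exp (-m) * ((1 + m) * w s - t s * w s) =
        Real.exp (-m) * Z := by
      rw [intervalIntegral.integral_const_mul,
        intervalIntegral.integral_sub (hw.const_mul _) htw,
        intervalIntegral.integral_const_mul, ← hZ, ← hM, ← hmZ]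
      ring
    rw [← heq]
    refine intervalIntegral.integral_mono_on huv
      (((hw.const_mul _).sub htw).const_mul _) hexp fun s hs => ?_
    have h1 : 1 + m - t s ≤ Real.exp (m - t s) := by
      linarith [Real.add_one_le_exp (m - t s)]
    have h2 : Real.exp (-t s) = Real.exp (-m) * Real.exp (m - t s) := by
      rw [← Real.exp_add]; ring_nf
    have h3 := mul_le_mul_of_nonneg_left h1 (mul_nonneg (Real.exp_pos (-m)).le (hw0 s hs))
    rw [h2]
    linarith
  have hle : Real.exp (-m) ≤ (∫ s in u..v, w s * Real.exp (-t s)) / Z :=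
    (le_div_iff₀ hpos).2 key
  exact (Real.le_log_iff_exp_le ((Real.exp_pos _).trans_le hle)).2 hle

theorem intervalIntegrable_one_sub_rpow_mul_one_add_rpow {κ : ℝ} (hκ : 0 < κ) :
    IntervalIntegrable (fun s : ℝ => (1 - s) ^ (κ - 1) * (1 + s) ^ κ) volume (-1) 1 := by
  have h : IntervalIntegrable (fun s : ℝ => (1 - s) ^ (κ - 1)) volume (-1) 1 := by
    have h0 := (intervalIntegral.intervalIntegrable_rpow' (a := 2) (b := 0)
      (r := κ - 1) (by linarith)).comp_sub_left 1
    norm_num at h0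
    exact h0
  refine h.mul_continuousOn (Continuous.continuousOn ?_)
  exact (continuous_const.add continuous_id).rpow_const fun _ => Or.inr hκ.le

/-- For `κ > 0` and `g(s) = (1−s)^{κ−1}(1+s)^{κ}` on `(−1,1)`, the function
`φ(a) = 2a (∫ s g(s) e^{as} ds)/(∫ g(s) e^{as} ds)
        + log((∫ g(s) e^{−as} ds)/(∫ g(s) e^{as} ds))`
is nonnegative on `ℝ` (all integrals over `(−1,1)`). -/
theorem stmt17 (κ : ℝ) (hκ : 0 < κ) (a : ℝ) :
    0 ≤ 2 * a * ((∫ s in (-1 : ℝ)..(1 : ℝ),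
          s * ((1 - s) ^ (κ - 1) * (1 + s) ^ κ) * Real.exp (a * s))
        / (∫ s in (-1 : ℝ)..(1 : ℝ),
          (1 - s) ^ (κ - 1) * (1 + s) ^ κ * Real.exp (a * s)))
      + Real.log ((∫ s in (-1 : ℝ)..(1 : ℝ),
          (1 - s) ^ (κ - 1) * (1 + s) ^ κ * Real.exp (-(a * s)))
        / (∫ s in (-1 : ℝ)..(1 : ℝ),
          (1 - s) ^ (κ - 1) * (1 + s) ^ κ * Real.exp (a * s))) := by
  have hg := intervalIntegrable_one_sub_rpow_mul_one_add_rpow hκ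
  have hw : IntervalIntegrable
      (fun s : ℝ => (1 - s) ^ (κ - 1) * (1 + s) ^ κ * Real.exp (a * s)) volume (-1) 1 :=
    hg.mul_continuousOn (by fun_prop)
  have hpos : 0 < ∫ s in (-1 : ℝ)..1,
      (1 - s) ^ (κ - 1) * (1 + s) ^ κ * Real.exp (a * s) := by
    refine intervalIntegral.intervalIntegral_pos_of_pos_on hw (fun s hs => ?_) (by norm_num)
    have h1 : 0 < 1 - s := by linarith [hs.2]
    have h2 : 0 < 1 + s := by linarith [hs.1]
    positivity
  have hexp : ∀ s : ℝ,
      (1 - s) ^ (κ - 1) * (1 + s) ^ κ * Real.exp (a * s) * Real.exp (-(2 * a * s)) =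
        (1 - s) ^ (κ - 1) * (1 + s) ^ κ * Real.exp (-(a * s)) := fun s => by
    rw [mul_assoc, ← Real.exp_add]
    ring_nf
  have hmean : ∀ s : ℝ,
      2 * a * s * ((1 - s) ^ (κ - 1) * (1 + s) ^ κ * Real.exp (a * s)) =
        2 * a * (s * ((1 - s) ^ (κ - 1) * (1 + s) ^ κ) * Real.exp (a * s)) := fun s => by
    ring
  have h := neg_mean_le_log_integral_exp_neg (t := fun s => 2 * a * s) (by norm_num) hw
    (hw.continuousOn_mul (by fun_prop)) (hw.mul_continuousOn (by fun_prop))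
    (fun s hs => by
      have h1 : 0 ≤ 1 - s := by linarith [hs.2]
      have h2 : 0 ≤ 1 + s := by linarith [hs.1]
      positivity) hpos
  simp only [hexp, hmean, intervalIntegral.integral_const_mul] at h
  rw [mul_div_assoc] at h
  linarith
end
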